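/- arXiv:0804.0807 — 2 statements merged into one kernel-verified Lean document; each statement's English description precedes it below -/
import Mathlib

section
/- Fix natural numbers k ≥ 3 and n ≥ 1, and let F be the free group on Fin k with basis x_0, …, x_{k-1}. For each index i with i + 1 < k, let φ_i : F → F be the homomorphism determined by φ_i(x_i) = x_i^n · x_{i+1} · x_i^{-n}, φ_i(x_{i+1}) = x_i, and φ_i(x_m) = x_m otherwise. Then for every i with i + 2 < k, the braid relation φ_i ∘ φ_{i+1} ∘ φ_i = φ_{i+1} ∘ φ_i ∘ φ_{i+1} holds (as an equality of group homomorphisms F → F). -/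
/-- `IsWada k n i hi φ` says that the endomorphism `φ` of the free group on `Fin k`
is Wada's endomorphism `φ_i` (with parameter `n`): it is determined on the basis by
`x_i ↦ x_i ^ n * x_{i+1} * x_i ^ (-n)`, `x_{i+1} ↦ x_i`, and `x_m ↦ x_m` for
`m ∉ {i, i+1}`. -/
def IsWada (k n i : ℕ) (hi : i + 1 < k)
    (φ : FreeGroup (Fin k) →* FreeGroup (Fin k)) : Prop :=
  φ (FreeGroup.of (⟨i, by omega⟩ : Fin k)) =
      FreeGroup.of (⟨i, by omega⟩ : Fin k) ^ n * FreeGroup.of (⟨i + 1, hi⟩ : Fin k) *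
        (FreeGroup.of (⟨i, by omega⟩ : Fin k) ^ n)⁻¹ ∧
  φ (FreeGroup.of (⟨i + 1, hi⟩ : Fin k)) = FreeGroup.of (⟨i, by omega⟩ : Fin k) ∧
  ∀ m : Fin k, (m : ℕ) ≠ i → (m : ℕ) ≠ i + 1 → φ (FreeGroup.of m) = FreeGroup.of m

/-- Wada's endomorphisms of the free group on `Fin k` satisfy the braid relation
`φ_i ∘ φ_{i+1} ∘ φ_i = φ_{i+1} ∘ φ_i ∘ φ_{i+1}` for every `i` with `i + 2 < k`. -/
theorem wada_braid_relation (k n : ℕ) (hk : 3 ≤ k) (hn : 1 ≤ n) (i : ℕ) (hi : i + 2 < k)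
    (φ ψ : FreeGroup (Fin k) →* FreeGroup (Fin k))
    (hφ : IsWada k n i (by omega) φ) (hψ : IsWada k n (i + 1) (by omega) ψ) :
    φ.comp (ψ.comp φ) = ψ.comp (φ.comp ψ) := by
  obtain ⟨φa, φb, φm⟩ := hφ
  obtain ⟨ψb, ψc, ψm⟩ := hψ
  have φc := φm ⟨i + 1 + 1, by omega⟩ (by simp; omega) (by simp)
  have ψa := ψm ⟨i, by omega⟩ (by simp) (by simp; omega)
  ext m
  by_cases ha : (m : ℕ) = i
  · rw [show m = ⟨i, by omega⟩ from Fin.ext ha]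
    simp only [MonoidHom.comp_apply, φa, φb, φc, ψa, ψb, map_mul, map_inv, map_pow, conj_pow]
    group
  by_cases hb : (m : ℕ) = i + 1
  · rw [show m = ⟨i + 1, by omega⟩ from Fin.ext hb]
    simp only [MonoidHom.comp_apply, φa, φb, φc, ψa, ψb, ψc, map_mul, map_inv, map_pow]
  by_cases hc : (m : ℕ) = i + 1 + 1
  · rw [show m = ⟨i + 1 + 1, by omega⟩ from Fin.ext hc]
    simp only [MonoidHom.comp_apply, φb, φc, ψa, ψc]
  · simp only [MonoidHom.comp_apply, φm m ha hb, ψm m hb hc]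
end

section
/- Fix natural numbers k ≥ 2 and n ≥ 1. Let B_k be the presented group on generators σ_0, …, σ_{k-2} with relators σ_i σ_{i+1} σ_i σ_{i+1}^{-1} σ_i^{-1} σ_{i+1}^{-1} for i + 2 < k - 1 + 1 (i.e. for consecutive pairs of generators) and σ_i σ_m σ_i^{-1} σ_m^{-1} for |i - m| ≥ 2 (the Artin braid group on k strands). Let F be the free group on Fin k, and for each i with i + 1 < k let Φ_i be the automorphism of F determined by x_i ↦ x_i^n · x_{i+1} · x_i^{-n}, x_{i+1} ↦ x_i, and x_m ↦ x_m otherwise. Then there exists a group homomorphism W : B_k → Aut(F) with W(σ_i) = Φ_i for every i. -/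
/-- The braid relators for the Artin braid group `B_k` on `k` strands, presented on
generators `σ_0, …, σ_{k-2}` indexed by `Fin (k-1)`: the relators
`σ_i σ_{i+1} σ_i σ_{i+1}⁻¹ σ_i⁻¹ σ_{i+1}⁻¹` for consecutive pairs of generators,
and the commutators `σ_i σ_m σ_i⁻¹ σ_m⁻¹` for `|i - m| ≥ 2`. -/
def braidRels (k : ℕ) : Set (FreeGroup (Fin (k - 1))) :=
  {r | ∃ (i : ℕ) (hi : i + 2 < k),
      r = FreeGroup.of (⟨i, by omega⟩ : Fin (k - 1)) *
          FreeGroup.of (⟨i + 1, by omega⟩ : Fin (k - 1)) *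
          FreeGroup.of (⟨i, by omega⟩ : Fin (k - 1)) *
          (FreeGroup.of (⟨i + 1, by omega⟩ : Fin (k - 1)))⁻¹ *
          (FreeGroup.of (⟨i, by omega⟩ : Fin (k - 1)))⁻¹ *
          (FreeGroup.of (⟨i + 1, by omega⟩ : Fin (k - 1)))⁻¹} ∪
  {r | ∃ (i m : ℕ) (hi : i + 1 < k) (hm : m + 1 < k), 2 ≤ |(i : ℤ) - (m : ℤ)| ∧
      r = FreeGroup.of (⟨i, by omega⟩ : Fin (k - 1)) *
          FreeGroup.of (⟨m, by omega⟩ : Fin (k - 1)) *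
          (FreeGroup.of (⟨i, by omega⟩ : Fin (k - 1)))⁻¹ *
          (FreeGroup.of (⟨m, by omega⟩ : Fin (k - 1)))⁻¹}

/-- Automorphisms of a free group which agree on the basis are equal. -/
theorem FreeGroup.mulAut_ext {α : Type*} {f g : MulAut (FreeGroup α)}
    (h : ∀ a, f (FreeGroup.of a) = g (FreeGroup.of a)) : f = g :=
  MulEquiv.toMonoidHom_injective (FreeGroup.ext_hom _ _ h)

/-- Wada's automorphisms at consecutive indices satisfy the braid relation. -/
theorem IsWada.braid {k n i : ℕ} (hi : i + 2 < k) {f g : MulAut (FreeGroup (Fin k))}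
    (hf : IsWada k n i (by omega) f.toMonoidHom) (hg : IsWada k n (i + 1) hi g.toMonoidHom) :
    f * g * f = g * f * g := by
  obtain ⟨hf₀, hf₁, hf₂⟩ := hf
  obtain ⟨hg₀, hg₁, hg₂⟩ := hg
  simp only [MulEquiv.toMonoidHom_eq_coe, MonoidHom.coe_coe] at hf₀ hf₁ hf₂ hg₀ hg₁ hg₂
  have hfc := hf₂ ⟨i + 1 + 1, hi⟩ (by simp only; omega) (by simp only; omega)
  have hga := hg₂ ⟨i, by omega⟩ (by simp only; omega) (by simp only; omega)
  refine FreeGroup.mulAut_ext fun a => ?_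
  simp only [MulAut.mul_apply]
  obtain rfl | ha := eq_or_ne a ⟨i, by omega⟩
  · simp only [hf₀, hf₁, hfc, hg₀, hga, map_mul, map_inv, map_pow, conj_pow]
    group
  obtain rfl | hb := eq_or_ne a ⟨i + 1, by omega⟩
  · simp only [hf₀, hf₁, hfc, hg₀, hg₁, hga, map_mul, map_inv, map_pow]
  obtain rfl | hc := eq_or_ne a ⟨i + 1 + 1, hi⟩
  · simp only [hf₁, hfc, hg₁, hga]
  rw [Ne, Fin.ext_iff] at ha hb hc
  simp only [hf₂ a ha hb, hg₂ a hb hc]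

/-- Wada's automorphisms at indices at distance at least two commute. -/
theorem IsWada.commute {k n i m : ℕ} {hi : i + 1 < k} {hm : m + 1 < k}
    (him : 2 ≤ |(i : ℤ) - (m : ℤ)|) {f g : MulAut (FreeGroup (Fin k))}
    (hf : IsWada k n i hi f.toMonoidHom) (hg : IsWada k n m hm g.toMonoidHom) :
    Commute f g := by
  rw [le_abs] at him
  obtain ⟨hf₀, hf₁, hf₂⟩ := hf
  obtain ⟨hg₀, hg₁, hg₂⟩ := hg
  simp only [MulEquiv.toMonoidHom_eq_coe, MonoidHom.coe_coe] at hf₀ hf₁ hf₂ hg₀ hg₁ hg₂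
  have hfa := hf₂ ⟨m, by omega⟩ (by simp only; omega) (by simp only; omega)
  have hfb := hf₂ ⟨m + 1, hm⟩ (by simp only; omega) (by simp only; omega)
  have hga := hg₂ ⟨i, by omega⟩ (by simp only; omega) (by simp only; omega)
  have hgb := hg₂ ⟨i + 1, hi⟩ (by simp only; omega) (by simp only; omega)
  refine FreeGroup.mulAut_ext fun a => ?_
  simp only [MulAut.mul_apply]
  obtain rfl | h₁ := eq_or_ne a ⟨i, by omega⟩
  · simp only [hf₀, hga, hgb, map_mul, map_inv, map_pow]
  obtain rfl | h₂ := eq_or_ne a ⟨i + 1, hi⟩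
  · simp only [hf₁, hga, hgb]
  obtain rfl | h₃ := eq_or_ne a ⟨m, by omega⟩
  · simp only [hg₀, hfa, hfb, map_mul, map_inv, map_pow]
  obtain rfl | h₄ := eq_or_ne a ⟨m + 1, hm⟩
  · simp only [hg₁, hfa, hfb]
  rw [Ne, Fin.ext_iff] at h₁ h₂ h₃ h₄
  simp only [hf₂ a h₁ h₂, hg₂ a h₃ h₄]

/-- Wada's representation: there is a group homomorphism from the Artin braid group
`B_k` (presented on generators `σ_0, …, σ_{k-2}` by the braid relators) to the
automorphism group of the free group `F` on `Fin k`, sending each generator `σ_i`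
to Wada's automorphism `Φ_i : x_i ↦ x_i ^ n * x_{i+1} * x_i ^ (-n)`,
`x_{i+1} ↦ x_i`, `x_m ↦ x_m` otherwise. -/
theorem wada_representation (k n : ℕ) (hk : 2 ≤ k) (hn : 1 ≤ n)
    (Φ : ∀ i : ℕ, i + 1 < k → MulAut (FreeGroup (Fin k)))
    (hΦ : ∀ (i : ℕ) (hi : i + 1 < k), IsWada k n i hi (Φ i hi).toMonoidHom) :
    ∃ W : PresentedGroup (braidRels k) →* MulAut (FreeGroup (Fin k)),
      ∀ (i : ℕ) (hi : i + 1 < k),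
        W (PresentedGroup.of (⟨i, by omega⟩ : Fin (k - 1))) = Φ i hi := by
  have hrels : ∀ r ∈ braidRels k, FreeGroup.lift
      (fun j : Fin (k - 1) => Φ j (by have := j.isLt; omega)) r = 1 := by
    rintro r (⟨i, hi, rfl⟩ | ⟨i, m, hi, hm, him, rfl⟩)
    · simp only [map_mul, map_inv, FreeGroup.lift_apply_of]
      rw [IsWada.braid hi (hΦ i (by omega)) (hΦ (i + 1) hi)]
      group
    · simp only [map_mul, map_inv, FreeGroup.lift_apply_of]
      rw [(IsWada.commute him (hΦ i hi) (hΦ m hm)).eq]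
      group
  exact ⟨PresentedGroup.toGroup hrels, fun _ _ => PresentedGroup.toGroup.of hrels⟩
end
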